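/- arXiv:1907.13614 — 8 statements merged into one kernel-verified Lean document; each statement's English description precedes it below -/
import Mathlib

section
/- Consider X = ℝ × ℂ × ℝ with coordinates p = (K, T, U), anchor ρ_p(z,λ) = (−2 Re(conj(T)·z), U·z − i·λ·T, −K·Re(conj(T)·z)) ∈ ℝ × ℂ × ℝ for (z,λ) ∈ ℂ × ℝ, and fiberwise bracket b_p((z,λ),(w,μ)) = (i·λ·w − i·μ·z, K·Im(conj(z)·w)) ∈ ℂ × ℝ. For infinitely differentiable sections s₁, s₂ : ℝ × ℂ × ℝ → ℂ × ℝ, define [s₁,s₂](p) = b_p(s₁(p), s₂(p)) + Ds₂|_p(ρ_p(s₁(p))) − Ds₁|_p(ρ_p(s₂(p))), where D denotes the Fréchet derivative. Then this bracket satisfies the Jacobi identity: [[s₁,s₂],s₃] + [[s₂,s₃],s₁] + [[s₃,s₁],s₂] = 0 for all infinitely differentiable sections s₁, s₂, s₃. -/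
namespace ExtremalKaehler

abbrev X := ℝ × ℂ × ℝ
abbrev V := ℂ × ℝ

/-- the anchor -/
noncomputable def rho (p : X) (v : V) : X :=
  (-2 * ((starRingEnd ℂ) p.2.1 * v.1).re,
       (p.2.2 : ℂ) * v.1 - Complex.I * (v.2 : ℂ) * p.2.1,
       -p.1 * ((starRingEnd ℂ) p.2.1 * v.1).re)

/-- derivative of the anchor in the base point -/
noncomputable def rhoD (p h : X) (v : V) : X :=
  (-2 * ((starRingEnd ℂ) h.2.1 * v.1).re,
       (h.2.2 : ℂ) * v.1 - Complex.I * (v.2 : ℂ) * h.2.1,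
       -h.1 * ((starRingEnd ℂ) p.2.1 * v.1).re - p.1 * ((starRingEnd ℂ) h.2.1 * v.1).re)

/-- the fiberwise bracket -/
noncomputable def bb (p : X) (v w : V) : V :=
  (Complex.I * (v.2 : ℂ) * w.1 - Complex.I * (w.2 : ℂ) * v.1,
       p.1 * ((starRingEnd ℂ) v.1 * w.1).im)

/-- the bracket of sections -/
noncomputable def brk (s₁ s₂ : X → V) (p : X) : V :=
  bb p (s₁ p) (s₂ p) + fderiv ℝ s₂ p (rho p (s₁ p)) - fderiv ℝ s₁ p (rho p (s₂ p))

/-- derivative of the fiberwise bracket in the base point -/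
noncomputable def bbD (h : X) (v w : V) : V :=
  (0, h.1 * ((starRingEnd ℂ) v.1 * w.1).im)

lemma rho_add (p : X) (v w : V) : rho p (v + w) = rho p v + rho p w := by
  simp only [rho, Prod.mk_add_mk, Prod.mk.injEq, Complex.ext_iff]
  simp
  refine ⟨?_, ⟨?_, ?_⟩, ?_⟩ <;> ring

lemma rho_sub (p : X) (v w : V) : rho p (v - w) = rho p v - rho p w := by
  simp only [rho, Prod.mk_sub_mk, Prod.mk.injEq, Complex.ext_iff]
  simp
  refine ⟨?_, ⟨?_, ?_⟩, ?_⟩ <;> ring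

lemma bb_add (p : X) (u v w : V) : bb p (u + v) w = bb p u w + bb p v w := by
  simp only [bb, Prod.mk_add_mk, Prod.mk.injEq, Complex.ext_iff]
  simp
  refine ⟨⟨?_, ?_⟩, ?_⟩ <;> ring

lemma bb_sub (p : X) (u v w : V) : bb p (u - v) w = bb p u w - bb p v w := by
  simp only [bb, Prod.mk_sub_mk, Prod.mk.injEq, Complex.ext_iff]
  simp
  refine ⟨⟨?_, ?_⟩, ?_⟩ <;> ring

lemma bb_swap (p : X) (u v : V) : bb p u v = - bb p v u := by
  simp only [bb, Prod.neg_mk, Prod.mk.injEq, Complex.ext_iff]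
  simp
  ring

/-- the anchor is a morphism on constant sections -/
lemma rho_bb (p : X) (v w : V) :
    rho p (bb p v w) = rhoD p (rho p v) w - rhoD p (rho p w) v := by
  simp only [rho, rhoD, bb, Prod.mk_sub_mk, Prod.mk.injEq, Complex.ext_iff]
  simp
  refine ⟨?_, ⟨?_, ?_⟩, ?_⟩ <;> ring

/-- Jacobi identity on constant sections -/
lemma jac (p : X) (u v w : V) :
    (bb p (bb p u v) w - bbD (rho p w) u v) + (bb p (bb p v w) u - bbD (rho p u) v w)
      + (bb p (bb p w u) v - bbD (rho p v) w u) = 0 := by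
  simp only [rho, bbD, bb, Prod.mk_sub_mk, Prod.mk_add_mk, Prod.mk_eq_zero, Complex.ext_iff]
  simp
  refine ⟨⟨?_, ?_⟩, ?_⟩ <;> ring

lemma hasDerivAt_conj {f : ℝ → ℂ} {f' : ℂ} (hf : HasDerivAt f f' 0) :
    HasDerivAt (fun t => (starRingEnd ℂ) (f t)) ((starRingEnd ℂ) f') 0 :=
  Complex.conjCLE.toContinuousLinearMap.hasFDerivAt.comp_hasDerivAt (0 : ℝ) hf

lemma hasDerivAt_re {f : ℝ → ℂ} {f' : ℂ} (hf : HasDerivAt f f' 0) :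
    HasDerivAt (fun t => (f t).re) f'.re 0 :=
  Complex.reCLM.hasFDerivAt.comp_hasDerivAt (0 : ℝ) hf

lemma hasDerivAt_im {f : ℝ → ℂ} {f' : ℂ} (hf : HasDerivAt f f' 0) :
    HasDerivAt (fun t => (f t).im) f'.im 0 :=
  Complex.imCLM.hasFDerivAt.comp_hasDerivAt (0 : ℝ) hf

lemma hasDerivAt_fst {E F : Type*} [NormedAddCommGroup E] [NormedSpace ℝ E]
    [NormedAddCommGroup F] [NormedSpace ℝ F] {f : ℝ → E × F} {f' : E × F}
    (hf : HasDerivAt f f' 0) : HasDerivAt (fun t => (f t).1) f'.1 0 :=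
  (ContinuousLinearMap.fst ℝ E F).hasFDerivAt.comp_hasDerivAt (0 : ℝ) hf

lemma hasDerivAt_snd {E F : Type*} [NormedAddCommGroup E] [NormedSpace ℝ E]
    [NormedAddCommGroup F] [NormedSpace ℝ F] {f : ℝ → E × F} {f' : E × F}
    (hf : HasDerivAt f f' 0) : HasDerivAt (fun t => (f t).2) f'.2 0 :=
  (ContinuousLinearMap.snd ℝ E F).hasFDerivAt.comp_hasDerivAt (0 : ℝ) hf

lemma hasDerivAt_rho {c : ℝ → X} {v : ℝ → V} {h : X} {v' : V}
    (hc : HasDerivAt c h 0) (hv : HasDerivAt v v' 0) :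
    HasDerivAt (fun t => rho (c t) (v t)) (rhoD (c 0) h (v 0) + rho (c 0) v') 0 := by
  have hK := hasDerivAt_fst hc
  have hT := hasDerivAt_fst (hasDerivAt_snd hc)
  have hU := (hasDerivAt_snd (hasDerivAt_snd hc)).ofReal_comp
  have hz := hasDerivAt_fst hv
  have hl := (hasDerivAt_snd hv).ofReal_comp
  have hr := hasDerivAt_re ((hasDerivAt_conj hT).mul hz)
  have := (hr.const_mul (-2)).prodMk
    (((hU.mul hz).sub ((hl.const_mul Complex.I).mul hT)).prodMk (hK.neg.mul hr))
  refine this.congr_deriv ?_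
  simp only [rho, rhoD, Prod.mk_add_mk, Prod.mk.injEq, Complex.ext_iff]
  simp
  refine ⟨?_, ⟨?_, ?_⟩, ?_⟩ <;> ring

lemma hasDerivAt_bb {c : ℝ → X} {v w : ℝ → V} {h : X} {v' w' : V}
    (hc : HasDerivAt c h 0) (hv : HasDerivAt v v' 0) (hw : HasDerivAt w w' 0) :
    HasDerivAt (fun t => bb (c t) (v t) (w t))
      (bbD h (v 0) (w 0) + bb (c 0) v' (w 0) + bb (c 0) (v 0) w') 0 := by
  have hK := hasDerivAt_fst hc
  have hz := hasDerivAt_fst hv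
  have hl := (hasDerivAt_snd hv).ofReal_comp
  have hz2 := hasDerivAt_fst hw
  have hl2 := (hasDerivAt_snd hw).ofReal_comp
  have hr := hasDerivAt_im ((hasDerivAt_conj hz).mul hz2)
  have := (((hl.const_mul Complex.I).mul hz2).sub ((hl2.const_mul Complex.I).mul hz)).prodMk
    (hK.mul hr)
  refine this.congr_deriv ?_
  simp only [bb, bbD, Prod.mk_add_mk, Prod.mk.injEq, Complex.ext_iff]
  simp
  refine ⟨⟨?_, ?_⟩, ?_⟩ <;> ring

lemma differentiable_brk {s₁ s₂ : X → V} (h₁ : ContDiff ℝ (⊤ : ℕ∞) s₁)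
    (h₂ : ContDiff ℝ (⊤ : ℕ∞) s₂) : Differentiable ℝ (brk s₁ s₂) := by
  have d₁ : Differentiable ℝ s₁ := h₁.differentiable (by simp)
  have d₂ : Differentiable ℝ s₂ := h₂.differentiable (by simp)
  have e₁ : Differentiable ℝ (fderiv ℝ s₁) :=
    (h₁.fderiv_right (m := 1) (by norm_cast)).differentiable (by simp)
  have e₂ : Differentiable ℝ (fderiv ℝ s₂) :=
    (h₂.fderiv_right (m := 1) (by norm_cast)).differentiable (by simp)
  have ho : Differentiable ℝ (fun x : ℝ => (x : ℂ)) := Complex.ofRealCLM.differentiable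
  have hre : Differentiable ℝ Complex.re := Complex.reCLM.differentiable
  have him : Differentiable ℝ Complex.im := Complex.imCLM.differentiable
  have hcj : Differentiable ℝ (fun z : ℂ => (starRingEnd ℂ) z) :=
    Complex.conjCLE.toContinuousLinearMap.differentiable
  have hrho : ∀ s : X → V, Differentiable ℝ s → Differentiable ℝ (fun p => rho p (s p)) := by
    intro s hs
    have hr : Differentiable ℝ (fun p : X => ((starRingEnd ℂ) p.2.1 * (s p).1).re) :=
      hre.comp ((hcj.comp (by fun_prop : Differentiable ℝ fun p : X => p.2.1)).mul hs.fst)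
    have hu : Differentiable ℝ (fun p : X => (p.2.2 : ℂ)) :=
      ho.comp (by fun_prop : Differentiable ℝ fun p : X => p.2.2)
    have hl : Differentiable ℝ (fun p : X => ((s p).2 : ℂ)) := ho.comp hs.snd
    unfold rho
    fun_prop
  have hbb : Differentiable ℝ (fun p => bb p (s₁ p) (s₂ p)) := by
    have hr : Differentiable ℝ (fun p : X => ((starRingEnd ℂ) (s₁ p).1 * (s₂ p).1).im) :=
      him.comp ((hcj.comp d₁.fst).mul d₂.fst)
    have hl : Differentiable ℝ (fun p : X => ((s₁ p).2 : ℂ)) := ho.comp d₁.snd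
    have hl2 : Differentiable ℝ (fun p : X => ((s₂ p).2 : ℂ)) := ho.comp d₂.snd
    unfold bb
    fun_prop
  exact (hbb.add (e₂.clm_apply (hrho _ d₁))).sub (e₁.clm_apply (hrho _ d₂))

lemma fderiv_brk {s₁ s₂ : X → V} (h₁ : ContDiff ℝ (⊤ : ℕ∞) s₁)
    (h₂ : ContDiff ℝ (⊤ : ℕ∞) s₂) (p h : X) :
    fderiv ℝ (brk s₁ s₂) p h =
      bbD h (s₁ p) (s₂ p) + bb p (fderiv ℝ s₁ p h) (s₂ p) + bb p (s₁ p) (fderiv ℝ s₂ p h)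
      + (fderiv ℝ (fderiv ℝ s₂) p h (rho p (s₁ p))
        + fderiv ℝ s₂ p (rhoD p h (s₁ p) + rho p (fderiv ℝ s₁ p h)))
      - (fderiv ℝ (fderiv ℝ s₁) p h (rho p (s₂ p))
        + fderiv ℝ s₁ p (rhoD p h (s₂ p) + rho p (fderiv ℝ s₂ p h))) := by
  have d₁ : Differentiable ℝ s₁ := h₁.differentiable (by simp)
  have d₂ : Differentiable ℝ s₂ := h₂.differentiable (by simp)
  have e₁ : Differentiable ℝ (fderiv ℝ s₁) :=
    (h₁.fderiv_right (m := 1) (by norm_cast)).differentiable (by simp)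
  have e₂ : Differentiable ℝ (fderiv ℝ s₂) :=
    (h₂.fderiv_right (m := 1) (by norm_cast)).differentiable (by simp)
  have hc : HasDerivAt (fun t : ℝ => p + t • h) h 0 := by
    simpa using ((hasDerivAt_id (0 : ℝ)).smul_const h).const_add p
  have key : ∀ {F : Type} [NormedAddCommGroup F] [NormedSpace ℝ F] (f : X → F),
      Differentiable ℝ f → HasDerivAt (fun t : ℝ => f (p + t • h)) (fderiv ℝ f p h) 0 := by
    intro F _ _ f hf
    have := (hf (p + (0 : ℝ) • h)).hasFDerivAt.comp_hasDerivAt (0 : ℝ) hc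
    simpa [Function.comp_def] using this
  have a := key _ (differentiable_brk h₁ h₂)
  have k₁ := key _ d₁
  have k₂ := key _ d₂
  have b := ((hasDerivAt_bb hc k₁ k₂).add ((key _ e₂).clm_apply (hasDerivAt_rho hc k₁))).sub
    ((key _ e₁).clm_apply (hasDerivAt_rho hc k₂))
  have := a.unique b
  simpa using this

lemma symm2 {s : X → V} (h : ContDiff ℝ (⊤ : ℕ∞) s) (p u v : X) :
    fderiv ℝ (fderiv ℝ s) p u v = fderiv ℝ (fderiv ℝ s) p v u :=
  (h.contDiffAt.isSymmSndFDerivAt (by simp; exact WithTop.coe_le_coe.2 (le_top : (2 : ℕ∞) ≤ ⊤))).eq u v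

lemma jacobi {s₁ s₂ s₃ : X → V} (h₁ : ContDiff ℝ (⊤ : ℕ∞) s₁)
    (h₂ : ContDiff ℝ (⊤ : ℕ∞) s₂) (h₃ : ContDiff ℝ (⊤ : ℕ∞) s₃) (p : X) :
    brk (brk s₁ s₂) s₃ p + brk (brk s₂ s₃) s₁ p + brk (brk s₃ s₁) s₂ p = 0 := by
  have e : ∀ {s t r : X → V}, ContDiff ℝ (⊤ : ℕ∞) s → ContDiff ℝ (⊤ : ℕ∞) t →
      brk (brk s t) r p = bb p (brk s t p) (r p) + fderiv ℝ r p (rho p (brk s t p))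
        - fderiv ℝ (brk s t) p (rho p (r p)) := fun _ _ => rfl
  rw [e h₁ h₂, e h₂ h₃, e h₃ h₁, fderiv_brk h₁ h₂, fderiv_brk h₂ h₃, fderiv_brk h₃ h₁]
  simp only [brk, rho_add, rho_sub, bb_add, bb_sub, map_add, map_sub, rho_bb]
  rw [symm2 h₁ p (rho p (s₃ p)), symm2 h₂ p (rho p (s₁ p)), symm2 h₃ p (rho p (s₂ p))]
  rw [bb_swap p (s₁ p) (fderiv ℝ s₂ p _), bb_swap p (s₂ p) (fderiv ℝ s₃ p _),
    bb_swap p (s₃ p) (fderiv ℝ s₁ p _)]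
  have j := jac p (s₁ p) (s₂ p) (s₃ p)
  rw [← j]
  abel

end ExtremalKaehler

/-- The bracket of the extremal Kähler algebroid on `X = ℝ × ℂ × ℝ` (fiberwise bracket plus
Leibniz-type derivative terms along the anchor) satisfies the Jacobi identity on smooth
sections. -/
theorem stmt_6
    (ρ : ℝ × ℂ × ℝ → ℂ × ℝ → ℝ × ℂ × ℝ)
    (hρ : ∀ p v, ρ p v =
      (-2 * ((starRingEnd ℂ) p.2.1 * v.1).re,
       (p.2.2 : ℂ) * v.1 - Complex.I * (v.2 : ℂ) * p.2.1,
       -p.1 * ((starRingEnd ℂ) p.2.1 * v.1).re))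
    (b : ℝ × ℂ × ℝ → ℂ × ℝ → ℂ × ℝ → ℂ × ℝ)
    (hb : ∀ p v w, b p v w =
      (Complex.I * (v.2 : ℂ) * w.1 - Complex.I * (w.2 : ℂ) * v.1,
       p.1 * ((starRingEnd ℂ) v.1 * w.1).im))
    (br : (ℝ × ℂ × ℝ → ℂ × ℝ) → (ℝ × ℂ × ℝ → ℂ × ℝ) → (ℝ × ℂ × ℝ → ℂ × ℝ))
    (hbr : ∀ s₁ s₂ p, br s₁ s₂ p =
      b p (s₁ p) (s₂ p) + fderiv ℝ s₂ p (ρ p (s₁ p)) - fderiv ℝ s₁ p (ρ p (s₂ p))) :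
    ∀ s₁ s₂ s₃ : ℝ × ℂ × ℝ → ℂ × ℝ,
      ContDiff ℝ (⊤ : ℕ∞) s₁ → ContDiff ℝ (⊤ : ℕ∞) s₂ → ContDiff ℝ (⊤ : ℕ∞) s₃ →
      ∀ p, br (br s₁ s₂) s₃ p + br (br s₂ s₃) s₁ p + br (br s₃ s₁) s₂ p = 0 := by
  obtain rfl : ρ = ExtremalKaehler.rho := by
    funext p v
    exact hρ p v
  obtain rfl : b = ExtremalKaehler.bb := by
    funext p v w
    exact hb p v w
  obtain rfl : br = ExtremalKaehler.brk := by
    funext s t p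
    exact hbr s t p
  intro s₁ s₂ s₃ h₁ h₂ h₃ p
  exact ExtremalKaehler.jacobi h₁ h₂ h₃ p
end

section
/- Consider X = ℝ × ℂ × ℝ with coordinates p = (K, T, U) and anchor ρ_p(z,λ) = (−2 Re(conj(T)·z), U·z − i·λ·T, −K·Re(conj(T)·z)) ∈ ℝ × ℂ × ℝ for (z,λ) ∈ ℂ × ℝ, and fiberwise bracket b_p((z,λ),(w,μ)) = (i·λ·w − i·μ·z, K·Im(conj(z)·w)) ∈ ℂ × ℝ. For each fixed (z,λ) ∈ ℂ × ℝ, let V_{(z,λ)} : ℝ × ℂ × ℝ → ℝ × ℂ × ℝ be the vector field V_{(z,λ)}(p) = ρ_p(z,λ). Then for all (z,λ), (w,μ) ∈ ℂ × ℝ and all p = (K,T,U): D V_{(w,μ)}|_p (V_{(z,λ)}(p)) − D V_{(z,λ)}|_p (V_{(w,μ)}(p)) = ρ_p(i·λ·w − i·μ·z, K·Im(conj(z)·w)), where D denotes the Fréchet derivative. That is, the Lie bracket of the anchor vector fields of two constant sections equals the anchor applied pointwise to their algebroid bracket. -/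
theorem anchor_fderiv (w : ℂ × ℝ) (p d : ℝ × ℂ × ℝ) :
    fderiv ℝ (fun p : ℝ × ℂ × ℝ => ((-2 * ((starRingEnd ℂ) p.2.1 * w.1).re,
       (p.2.2 : ℂ) * w.1 - Complex.I * (w.2 : ℂ) * p.2.1,
       -p.1 * ((starRingEnd ℂ) p.2.1 * w.1).re) : ℝ × ℂ × ℝ)) p d =
      (-2 * ((starRingEnd ℂ) d.2.1 * w.1).re,
       (d.2.2 : ℂ) * w.1 - Complex.I * (w.2 : ℂ) * d.2.1,
       -d.1 * ((starRingEnd ℂ) p.2.1 * w.1).re - p.1 * ((starRingEnd ℂ) d.2.1 * w.1).re) := by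
  have hK : HasFDerivAt (fun p : ℝ × ℂ × ℝ => p.1) (ContinuousLinearMap.fst ℝ ℝ (ℂ × ℝ)) p :=
    hasFDerivAt_fst
  have hT : HasFDerivAt (fun p : ℝ × ℂ × ℝ => p.2.1)
      ((ContinuousLinearMap.fst ℝ ℂ ℝ).comp (ContinuousLinearMap.snd ℝ ℝ (ℂ × ℝ))) p :=
    ((ContinuousLinearMap.fst ℝ ℂ ℝ).comp (ContinuousLinearMap.snd ℝ ℝ (ℂ × ℝ))).hasFDerivAt
  have hU : HasFDerivAt (fun p : ℝ × ℂ × ℝ => (p.2.2 : ℂ))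
      (Complex.ofRealCLM.comp
        ((ContinuousLinearMap.snd ℝ ℂ ℝ).comp (ContinuousLinearMap.snd ℝ ℝ (ℂ × ℝ)))) p :=
    (Complex.ofRealCLM.comp
        ((ContinuousLinearMap.snd ℝ ℂ ℝ).comp
          (ContinuousLinearMap.snd ℝ ℝ (ℂ × ℝ)))).hasFDerivAt
  have hC : HasFDerivAt (fun p : ℝ × ℂ × ℝ => (starRingEnd ℂ) p.2.1) _ p :=
    (Complex.conjCLE.toContinuousLinearMap.hasFDerivAt).comp p hT
  have hR : HasFDerivAt (fun p : ℝ × ℂ × ℝ => ((starRingEnd ℂ) p.2.1 * w.1).re) _ p :=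
    (Complex.reCLM.hasFDerivAt).comp p (hC.mul_const w.1)
  have h := (hR.const_mul (-2)).prodMk
    (((hU.mul_const w.1).sub (hT.const_mul (Complex.I * (w.2 : ℂ)))).prodMk (hK.neg.mul hR))
  refine (congrArg (fun L => L d) (HasFDerivAt.fderiv h)).trans ?_
  refine Prod.ext ?_ (Prod.ext ?_ ?_)
  · simp
    try ring
  · simp
    try ring
  · simp
    try ring

/-- For the extremal Kähler algebroid on `X = ℝ × ℂ × ℝ`, the Lie bracket of the anchor
vector fields of two constant sections equals the anchor of their fiberwise bracket. -/
theorem stmt_7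
    (ρ : ℝ × ℂ × ℝ → ℂ × ℝ → ℝ × ℂ × ℝ)
    (hρ : ∀ p v, ρ p v =
      (-2 * ((starRingEnd ℂ) p.2.1 * v.1).re,
       (p.2.2 : ℂ) * v.1 - Complex.I * (v.2 : ℂ) * p.2.1,
       -p.1 * ((starRingEnd ℂ) p.2.1 * v.1).re))
    (b : ℝ × ℂ × ℝ → ℂ × ℝ → ℂ × ℝ → ℂ × ℝ)
    (hb : ∀ p v w, b p v w =
      (Complex.I * (v.2 : ℂ) * w.1 - Complex.I * (w.2 : ℂ) * v.1,
       p.1 * ((starRingEnd ℂ) v.1 * w.1).im)) :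
    ∀ (v w : ℂ × ℝ) (p : ℝ × ℂ × ℝ),
      fderiv ℝ (fun q => ρ q w) p (ρ p v) - fderiv ℝ (fun q => ρ q v) p (ρ p w)
        = ρ p (b p v w) := by
  intro v w p
  simp only [hρ, hb, anchor_fderiv]
  obtain ⟨K, T, U⟩ := p
  obtain ⟨z, l⟩ := v
  obtain ⟨w, m⟩ := w
  refine Prod.ext ?_ (Prod.ext (Complex.ext ?_ ?_) ?_) <;> simp <;> ring
end

section
/- Consider X = ℝ × ℂ × ℝ with coordinates p = (K, T, U), anchor ρ_p(z,λ) = (−2 Re(conj(T)·z), U·z − i·λ·T, −K·Re(conj(T)·z)) ∈ ℝ × ℂ × ℝ for (z,λ) ∈ ℂ × ℝ, and the functions I₁(K,T,U) = K²/4 − U and I₂(K,T,U) = |T|² + K·U − K³/6. Then for every p ∈ ℝ × ℂ × ℝ and every (z,λ) ∈ ℂ × ℝ, the Fréchet derivatives satisfy D I₁|_p (ρ_p(z,λ)) = 0 and D I₂|_p (ρ_p(z,λ)) = 0; that is, I₁ and I₂ are constant along all anchor directions of the extremal Kähler algebroid. -/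
/-- The invariants `I₁ = K²/4 − U` and `I₂ = |T|² + KU − K³/6` are annihilated by every
anchor direction of the extremal Kähler algebroid on `X = ℝ × ℂ × ℝ`. -/
theorem stmt_8
    (ρ : ℝ × ℂ × ℝ → ℂ × ℝ → ℝ × ℂ × ℝ)
    (hρ : ∀ p v, ρ p v =
      (-2 * ((starRingEnd ℂ) p.2.1 * v.1).re,
       (p.2.2 : ℂ) * v.1 - Complex.I * (v.2 : ℂ) * p.2.1,
       -p.1 * ((starRingEnd ℂ) p.2.1 * v.1).re))
    (I₁ I₂ : ℝ × ℂ × ℝ → ℝ)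
    (hI₁ : ∀ p, I₁ p = p.1 ^ 2 / 4 - p.2.2)
    (hI₂ : ∀ p, I₂ p = Complex.normSq p.2.1 + p.1 * p.2.2 - p.1 ^ 3 / 6) :
    ∀ (p : ℝ × ℂ × ℝ) (v : ℂ × ℝ),
      fderiv ℝ I₁ p (ρ p v) = 0 ∧ fderiv ℝ I₂ p (ρ p v) = 0 := by
  intro p v
  have hK : HasFDerivAt (fun q : ℝ × ℂ × ℝ => q.1)
      (ContinuousLinearMap.fst ℝ ℝ (ℂ × ℝ)) p := hasFDerivAt_fst
  have hS : HasFDerivAt (fun q : ℝ × ℂ × ℝ => q.2)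
      (ContinuousLinearMap.snd ℝ ℝ (ℂ × ℝ)) p := hasFDerivAt_snd
  have hU : HasFDerivAt (fun q : ℝ × ℂ × ℝ => q.2.2)
      ((ContinuousLinearMap.snd ℝ ℂ ℝ).comp (ContinuousLinearMap.snd ℝ ℝ (ℂ × ℝ))) p :=
    ((ContinuousLinearMap.snd ℝ ℂ ℝ).comp (ContinuousLinearMap.snd ℝ ℝ (ℂ × ℝ))).hasFDerivAt
  have hx : HasFDerivAt (fun q : ℝ × ℂ × ℝ => q.2.1.re)
      (Complex.reCLM.comp ((ContinuousLinearMap.fst ℝ ℂ ℝ).comp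
        (ContinuousLinearMap.snd ℝ ℝ (ℂ × ℝ)))) p :=
    (Complex.reCLM.comp ((ContinuousLinearMap.fst ℝ ℂ ℝ).comp
        (ContinuousLinearMap.snd ℝ ℝ (ℂ × ℝ)))).hasFDerivAt
  have hy : HasFDerivAt (fun q : ℝ × ℂ × ℝ => q.2.1.im)
      (Complex.imCLM.comp ((ContinuousLinearMap.fst ℝ ℂ ℝ).comp
        (ContinuousLinearMap.snd ℝ ℝ (ℂ × ℝ)))) p :=
    (Complex.imCLM.comp ((ContinuousLinearMap.fst ℝ ℂ ℝ).comp
        (ContinuousLinearMap.snd ℝ ℝ (ℂ × ℝ)))).hasFDerivAt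
  have e1 : I₁ = fun q => (1 / 4 : ℝ) * (q.1 * q.1) - q.2.2 := by
    funext q; rw [hI₁]; ring
  have e2 : I₂ = fun q => q.2.1.re * q.2.1.re + q.2.1.im * q.2.1.im + q.1 * q.2.2
      - (1 / 6 : ℝ) * (q.1 * (q.1 * q.1)) := by
    funext q; rw [hI₂, Complex.normSq_apply]; ring
  have h1 := ((hK.mul hK).const_mul (1 / 4 : ℝ)).sub hU
  have h2 := (((hx.mul hx).add (hy.mul hy)).add (hK.mul hU)).sub
    ((hK.mul (hK.mul hK)).const_mul (1 / 6 : ℝ))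
  constructor
  · rw [e1]
    erw [h1.fderiv]
    rw [hρ]
    simp
    ring
  · rw [e2]
    erw [h2.fderiv]
    rw [hρ]
    simp
    ring
end

section
/- Let I₁, I₂ : ℝ × ℂ × ℝ → ℝ be the functions I₁(K,T,U) = K²/4 − U and I₂(K,T,U) = |T|² + K·U − K³/6. Then at a point p = (K,T,U), the Fréchet derivatives D I₁|_p and D I₂|_p (as continuous linear functionals on ℝ × ℂ × ℝ) are linearly independent over ℝ if and only if (T,U) ≠ (0,0). -/
theorem aux_fderiv_one (p v : ℝ × ℂ × ℝ) :
    fderiv ℝ (fun p : ℝ × ℂ × ℝ => p.1 ^ 2 / 4 - p.2.2) p v = p.1 / 2 * v.1 - v.2.2 := by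
  have h1 : HasFDerivAt (fun p : ℝ × ℂ × ℝ => p.1) (ContinuousLinearMap.fst ℝ ℝ (ℂ × ℝ)) p :=
    hasFDerivAt_fst
  have h2 : HasFDerivAt (fun p : ℝ × ℂ × ℝ => p.2.2)
      ((ContinuousLinearMap.snd ℝ ℂ ℝ).comp (ContinuousLinearMap.snd ℝ ℝ (ℂ × ℝ))) p :=
    ((ContinuousLinearMap.snd ℝ ℂ ℝ).comp (ContinuousLinearMap.snd ℝ ℝ (ℂ × ℝ))).hasFDerivAt
  have h := ((h1.mul h1).mul_const (1 / 4 : ℝ)).sub h2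
  have e : (fun p : ℝ × ℂ × ℝ => p.1 ^ 2 / 4 - p.2.2) =
      (fun p : ℝ × ℂ × ℝ => p.1 * p.1 * (1 / 4) - p.2.2) := by
    funext q; ring
  rw [e]
  refine (congrArg (fun L => L v) h.fderiv).trans ?_
  simp
  ring

theorem aux_fderiv_two (p v : ℝ × ℂ × ℝ) :
    fderiv ℝ (fun p : ℝ × ℂ × ℝ => Complex.normSq p.2.1 + p.1 * p.2.2 - p.1 ^ 3 / 6) p v =
      2 * p.2.1.re * v.2.1.re + 2 * p.2.1.im * v.2.1.im + p.1 * v.2.2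
        + (p.2.2 - p.1 ^ 2 / 2) * v.1 := by
  have h1 : HasFDerivAt (fun p : ℝ × ℂ × ℝ => p.1) (ContinuousLinearMap.fst ℝ ℝ (ℂ × ℝ)) p :=
    hasFDerivAt_fst
  have h2 : HasFDerivAt (fun p : ℝ × ℂ × ℝ => p.2.2)
      ((ContinuousLinearMap.snd ℝ ℂ ℝ).comp (ContinuousLinearMap.snd ℝ ℝ (ℂ × ℝ))) p :=
    ((ContinuousLinearMap.snd ℝ ℂ ℝ).comp (ContinuousLinearMap.snd ℝ ℝ (ℂ × ℝ))).hasFDerivAt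
  have h3 : HasFDerivAt (fun p : ℝ × ℂ × ℝ => p.2.1.re)
      (Complex.reCLM.comp
        ((ContinuousLinearMap.fst ℝ ℂ ℝ).comp (ContinuousLinearMap.snd ℝ ℝ (ℂ × ℝ)))) p :=
    (Complex.reCLM.comp
      ((ContinuousLinearMap.fst ℝ ℂ ℝ).comp (ContinuousLinearMap.snd ℝ ℝ (ℂ × ℝ)))).hasFDerivAt
  have h4 : HasFDerivAt (fun p : ℝ × ℂ × ℝ => p.2.1.im)
      (Complex.imCLM.comp
        ((ContinuousLinearMap.fst ℝ ℂ ℝ).comp (ContinuousLinearMap.snd ℝ ℝ (ℂ × ℝ)))) p :=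
    (Complex.imCLM.comp
      ((ContinuousLinearMap.fst ℝ ℂ ℝ).comp (ContinuousLinearMap.snd ℝ ℝ (ℂ × ℝ)))).hasFDerivAt
  have h := ((((h3.mul h3).add (h4.mul h4)).add (h1.mul h2))).sub
    (((h1.mul h1).mul h1).mul_const (1 / 6 : ℝ))
  have e : (fun p : ℝ × ℂ × ℝ => Complex.normSq p.2.1 + p.1 * p.2.2 - p.1 ^ 3 / 6) =
      (fun p : ℝ × ℂ × ℝ => p.2.1.re * p.2.1.re + p.2.1.im * p.2.1.im + p.1 * p.2.2
        - p.1 * p.1 * p.1 * (1 / 6)) := by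
    funext q; rw [Complex.normSq_apply]; ring
  rw [e]
  refine (congrArg (fun L => L v) h.fderiv).trans ?_
  simp
  ring

/-- The differentials of `I₁ = K²/4 − U` and `I₂ = |T|² + KU − K³/6` at `p = (K,T,U)` are
linearly independent over `ℝ` if and only if `(T,U) ≠ (0,0)`. -/
theorem stmt_9
    (I₁ I₂ : ℝ × ℂ × ℝ → ℝ)
    (hI₁ : ∀ p, I₁ p = p.1 ^ 2 / 4 - p.2.2)
    (hI₂ : ∀ p, I₂ p = Complex.normSq p.2.1 + p.1 * p.2.2 - p.1 ^ 3 / 6)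
    (p : ℝ × ℂ × ℝ) :
    LinearIndependent ℝ ![fderiv ℝ I₁ p, fderiv ℝ I₂ p] ↔ (p.2.1, p.2.2) ≠ (0, 0) := by
  obtain rfl : I₁ = _ := funext hI₁
  obtain rfl : I₂ = _ := funext hI₂
  rw [LinearIndependent.pair_iff]
  constructor
  · intro h h0
    obtain ⟨hT, hU⟩ := Prod.mk.inj h0
    have := (h p.1 1 (by
      refine ContinuousLinearMap.ext fun v => ?_
      rw [add_apply, smul_apply, smul_apply, aux_fderiv_one, aux_fderiv_two, hT, hU]
      simp
      ring)).2
    exact one_ne_zero this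
  · intro h s t hst
    have key : ∀ v : ℝ × ℂ × ℝ, s * (p.1 / 2 * v.1 - v.2.2) +
        t * (2 * p.2.1.re * v.2.1.re + 2 * p.2.1.im * v.2.1.im + p.1 * v.2.2
        + (p.2.2 - p.1 ^ 2 / 2) * v.1) = 0 := by
      intro v
      rw [← aux_fderiv_one, ← aux_fderiv_two]
      exact congrArg (fun L => L v) hst
    have k1 := key (1, 0, 0)
    have k2 := key (0, 1, 0)
    have k3 := key (0, Complex.I, 0)
    have k4 := key (0, 0, 1)
    simp at k1 k2 k3 k4
    have hs : s = t * p.1 := by linarith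
    have ht : t = 0 := by
      by_contra ht
      apply h
      have hU : t * p.2.2 = 0 := by rw [hs] at k1; linarith
      have hU := (mul_eq_zero.1 hU).resolve_left ht
      have hr := k2.resolve_left ht
      have hi := k3.resolve_left ht
      exact Prod.ext (Complex.ext hr hi) hU
    exact ⟨by rw [hs, ht, zero_mul], ht⟩
end

section
/- Let c₁, c₂ ∈ ℝ, let p(K) = −K³/12 + c₁·K + c₂, and let r₂ < r₃ be real numbers with p(r₂) = p(r₃) = 0 and p(K) > 0 for all K with r₂ < K < r₃. Then the set L = {(K,T,U) ∈ ℝ × ℂ × ℝ : K²/4 − U = c₁, |T|² + K·U − K³/6 = c₂, r₂ ≤ K ≤ r₃}, equipped with the subspace topology, is homeomorphic to the unit sphere S² in three-dimensional Euclidean space. -/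
lemma aux_sq (x y : ℝ) (h : x ^ 2 + y ^ 2 = 0) : x = 0 ∧ y = 0 := by
  have hx : x ^ 2 = 0 := by linarith [sq_nonneg x, sq_nonneg y]
  have hy : y ^ 2 = 0 := by linarith [sq_nonneg x, sq_nonneg y]
  exact ⟨pow_eq_zero_iff (two_ne_zero) |>.1 hx, pow_eq_zero_iff (two_ne_zero) |>.1 hy⟩

set_option maxHeartbeats 2000000 in
/-- If `r₂ < r₃` are consecutive roots of `p(K) = −K³/12 + c₁K + c₂` with `p > 0` between
them, then the piece of the level set `{I₁ = c₁, I₂ = c₂}` in `ℝ × ℂ × ℝ` lying over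
`r₂ ≤ K ≤ r₃` is homeomorphic to the unit 2-sphere. -/
theorem stmt_13 (c₁ c₂ r₂ r₃ : ℝ) (p : ℝ → ℝ)
    (hp : ∀ K, p K = -K ^ 3 / 12 + c₁ * K + c₂)
    (hr : r₂ < r₃) (h₂ : p r₂ = 0) (h₃ : p r₃ = 0)
    (hpos : ∀ K, r₂ < K → K < r₃ → 0 < p K)
    (L : Set (ℝ × ℂ × ℝ))
    (hL : L = {q : ℝ × ℂ × ℝ |
      q.1 ^ 2 / 4 - q.2.2 = c₁ ∧
      Complex.normSq q.2.1 + q.1 * q.2.2 - q.1 ^ 3 / 6 = c₂ ∧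
      r₂ ≤ q.1 ∧ q.1 ≤ r₃}) :
    Nonempty (L ≃ₜ Metric.sphere (0 : EuclideanSpace ℝ (Fin 3)) 1) := by
  obtain ⟨a, ha⟩ : ∃ a, a = (r₃ - r₂) / 2 := ⟨_, rfl⟩
  obtain ⟨m, hm⟩ : ∃ m, m = (r₂ + r₃) / 2 := ⟨_, rfl⟩
  have ha0 : 0 < a := by linarith
  have e2 : r₂ = m - a := by linarith
  have e3 : r₃ = m + a := by linarith
  have hc1 : c₁ = (r₃ ^ 2 + r₂ * r₃ + r₂ ^ 2) / 12 := by
    have h : (r₃ - r₂) * (c₁ - (r₃ ^ 2 + r₂ * r₃ + r₂ ^ 2) / 12) = 0 := by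
      rw [hp] at h₂ h₃
      linear_combination h₃ - h₂
    rcases mul_eq_zero.1 h with h | h <;> linarith
  have hc2 : c₂ = r₂ ^ 3 / 12 - c₁ * r₂ := by
    rw [hp] at h₂; linarith
  have hfac : ∀ K, p K = (K - r₂) * (r₃ - K) * ((K + 2 * m) / 12) := by
    intro K
    rw [hp, hc2, hc1, hm]; ring
  have hqpos : ∀ K, r₂ < K → K < r₃ → 0 < (K + 2 * m) / 12 := by
    intro K h1 h2
    have h := hpos K h1 h2
    rw [hfac] at h
    exact pos_of_mul_pos_right h (mul_nonneg (by linarith) (by linarith))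
  have hqnn : ∀ K, r₂ ≤ K → 0 ≤ (K + 2 * m) / 12 := by
    intro K h1
    by_contra hneg
    have h := hqpos (min m (-(2 * m))) (lt_min (by linarith) (by linarith))
      (lt_of_le_of_lt (min_le_left _ _) (by linarith))
    have := min_le_right m (-(2 * m))
    linarith
  -- membership in the level set
  have hmem : ∀ q : ℝ × ℂ × ℝ, q ∈ L ↔
      q.2.2 = q.1 ^ 2 / 4 - c₁ ∧ Complex.normSq q.2.1 = p q.1 ∧ r₂ ≤ q.1 ∧ q.1 ≤ r₃ := by
    intro q
    rw [hL, hp]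
    constructor
    · rintro ⟨h1, h2, h3⟩
      have h4 : q.2.2 = q.1 ^ 2 / 4 - c₁ := by linarith
      refine ⟨h4, ?_, h3⟩
      rw [h4] at h2
      linear_combination h2
    · rintro ⟨h1, h2, h3⟩
      refine ⟨by linarith, ?_, h3⟩
      rw [h1, h2]; ring
  have hsph : ∀ v : EuclideanSpace ℝ (Fin 3), v ∈ Metric.sphere (0 : EuclideanSpace ℝ (Fin 3)) 1 ↔
      v 0 ^ 2 + v 1 ^ 2 + v 2 ^ 2 = 1 := by
    intro v
    rw [mem_sphere_zero_iff_norm, EuclideanSpace.norm_eq, Real.sqrt_eq_one, Fin.sum_univ_three]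
    simp only [Real.norm_eq_abs, sq_abs]
  let g : EuclideanSpace ℝ (Fin 3) → ℝ := fun v => a * √((m + a * v 2 + 2 * m) / 12)
  let F : EuclideanSpace ℝ (Fin 3) → ℝ × ℂ × ℝ := fun v =>
    (m + a * v 2, ((g v : ℝ) : ℂ) * ((v 0 : ℝ) + (v 1 : ℝ) * Complex.I),
      (m + a * v 2) ^ 2 / 4 - c₁)
  have hFc : Continuous F := by
    simp only [F, g]
    fun_prop
  have hz : ∀ v : EuclideanSpace ℝ (Fin 3), v 0 ^ 2 + v 1 ^ 2 + v 2 ^ 2 = 1 →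
      -1 ≤ v 2 ∧ v 2 ≤ 1 := by
    intro v hv
    constructor <;> nlinarith [sq_nonneg (v 0), sq_nonneg (v 1)]
  have hFL : ∀ v ∈ Metric.sphere (0 : EuclideanSpace ℝ (Fin 3)) 1, F v ∈ L := by
    intro v hv
    rw [hsph] at hv
    obtain ⟨h1, h2⟩ := hz v hv
    have hk2 : r₂ ≤ m + a * v 2 := by nlinarith
    have hk3 : m + a * v 2 ≤ r₃ := by nlinarith
    rw [hmem]
    refine ⟨rfl, ?_, hk2, hk3⟩
    have hs := Real.mul_self_sqrt (hqnn _ hk2)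
    simp only [F, g, hfac, Complex.normSq_mul, Complex.normSq_ofReal, Complex.normSq_add_mul_I]
    rw [e2, e3]
    have : v 0 ^ 2 + v 1 ^ 2 = 1 - v 2 ^ 2 := by linarith
    rw [this]
    linear_combination a ^ 2 * (1 - v 2 ^ 2) * hs
  let f : Metric.sphere (0 : EuclideanSpace ℝ (Fin 3)) 1 → L := fun v => ⟨F v, hFL v v.2⟩
  have hfc : Continuous f := (hFc.comp continuous_subtype_val).subtype_mk _
  have hgpos : ∀ v : EuclideanSpace ℝ (Fin 3), -1 < v 2 → v 2 < 1 → 0 < g v := by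
    intro v h1 h2
    exact mul_pos ha0 (Real.sqrt_pos.2 (hqpos _ (by nlinarith) (by nlinarith)))
  have hinj : Function.Injective f := by
    rintro ⟨v, hv⟩ ⟨w, hw⟩ h
    have h' : F v = F w := congrArg Subtype.val h
    rw [hsph] at hv hw
    have hK : m + a * v 2 = m + a * w 2 := congrArg Prod.fst h'
    have h2 : v 2 = w 2 := mul_left_cancel₀ ha0.ne' (by linarith)
    have hg : g v = g w := by simp only [g, h2]
    have hT : ((g v : ℝ) : ℂ) * ((v 0 : ℝ) + (v 1 : ℝ) * Complex.I) =
      ((g w : ℝ) : ℂ) * ((w 0 : ℝ) + (w 1 : ℝ) * Complex.I) := congrArg (fun q => q.2.1) h'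
    have h01 : v 0 = w 0 ∧ v 1 = w 1 := by
      by_cases hv2 : v 2 ^ 2 = 1
      · have hw2 : w 2 ^ 2 = 1 := by rw [← h2]; exact hv2
        have a1 : v 0 = 0 := (aux_sq (v 0) (v 1) (by linarith)).1
        have a2 : v 1 = 0 := (aux_sq (v 0) (v 1) (by linarith)).2
        have a3 : w 0 = 0 := (aux_sq (w 0) (w 1) (by linarith)).1
        have a4 : w 1 = 0 := (aux_sq (w 0) (w 1) (by linarith)).2
        rw [a1, a2, a3, a4]; exact ⟨rfl, rfl⟩
      · obtain ⟨b1, b2⟩ := hz v hv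
        have hgv := hgpos v (lt_of_le_of_ne b1 (fun h => hv2 (by rw [← h]; norm_num)))
          (lt_of_le_of_ne b2 (fun h => hv2 (by rw [h]; norm_num)))
        rw [← hg] at hT
        have hT' := mul_left_cancel₀ (Complex.ofReal_ne_zero.2 hgv.ne') hT
        have hre := congrArg Complex.re hT'
        have him := congrArg Complex.im hT'
        simp at hre him
        exact ⟨hre, him⟩
    apply Subtype.ext
    ext i
    fin_cases i
    · exact h01.1
    · exact h01.2
    · exact h2
  have hsurj : Function.Surjective f := by
    rintro ⟨⟨K, T, U⟩, hq⟩
    have hq' := (hmem _).1 hq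
    simp only at hq'
    obtain ⟨hU, hT, hK2, hK3⟩ := hq'
    suffices h : ∃ v : EuclideanSpace ℝ (Fin 3), v 0 ^ 2 + v 1 ^ 2 + v 2 ^ 2 = 1 ∧
        m + a * v 2 = K ∧ ((g v : ℝ) : ℂ) * ((v 0 : ℝ) + (v 1 : ℝ) * Complex.I) = T by
      obtain ⟨v, hv, hvK, hvT⟩ := h
      refine ⟨⟨v, (hsph v).2 hv⟩, Subtype.ext ?_⟩
      simp only [f, F]
      rw [hvT, hvK, hU]
    rcases eq_or_lt_of_le hK2 with h | h2
    · have hT0 : T = 0 := by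
        rw [← h, h₂] at hT; exact Complex.normSq_eq_zero.1 hT
      refine ⟨!₂[0, 0, -1], by simp, ?_, ?_⟩
      · simp; linarith
      · simp [hT0]
    rcases eq_or_lt_of_le hK3 with h | h3
    · have hT0 : T = 0 := by
        rw [h, h₃] at hT; exact Complex.normSq_eq_zero.1 hT
      refine ⟨!₂[0, 0, 1], by simp, ?_, ?_⟩
      · simp; linarith
      · simp [hT0]
    · have hq0 := hqpos K h2 h3
      obtain ⟨s, hs⟩ : ∃ s, s = a * √((K + 2 * m) / 12) := ⟨_, rfl⟩
      have hs0 : 0 < s := by rw [hs]; exact mul_pos ha0 (Real.sqrt_pos.2 hq0)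
      have hss : s ^ 2 = a ^ 2 * ((K + 2 * m) / 12) := by
        rw [hs, mul_pow, Real.sq_sqrt hq0.le]
      have hKz : m + a * ((K - m) / a) = K := by field_simp; ring
      refine ⟨!₂[T.re / s, T.im / s, (K - m) / a], ?_, ?_, ?_⟩
      · simp only [PiLp.toLp_apply, Matrix.cons_val]
        have hn : T.re ^ 2 + T.im ^ 2 = s ^ 2 * (1 - ((K - m) / a) ^ 2) := by
          have h5 : T.re ^ 2 + T.im ^ 2 = p K := by
            rw [← hT, Complex.normSq_apply]; ring
          rw [h5, hfac, hss, e2, e3]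
          field_simp
          ring
        have h6 : (T.re / s) ^ 2 + (T.im / s) ^ 2 = (T.re ^ 2 + T.im ^ 2) / s ^ 2 := by
          field_simp
        rw [h6, hn, mul_div_cancel_left₀ _ (pow_ne_zero 2 hs0.ne')]
        ring
      · simpa using hKz
      · simp only [g, PiLp.toLp_apply, Matrix.cons_val]
        rw [hKz, ← hs]
        apply Complex.ext
        · simp; field_simp
        · simp; field_simp
  exact ⟨(hfc.homeoOfEquivCompactToT2 (f := Equiv.ofBijective f ⟨hinj, hsurj⟩)).symm⟩
end

section
/- Let c₁, c₂ ∈ ℝ, let p(K) = −K³/12 + c₁·K + c₂, and let r₁ ∈ ℝ satisfy p(r₁) = 0 and p(K) > 0 for all K < r₁. Then the set L = {(K,T,U) ∈ ℝ × ℂ × ℝ : K²/4 − U = c₁, |T|² + K·U − K³/6 = c₂, K ≤ r₁}, equipped with the subspace topology, is homeomorphic to ℝ² (equivalently, to ℂ). -/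
theorem polar_cont {X : Type*} [TopologicalSpace X] (g : X → ℝ) (h : X → ℂ)
    (hg : Continuous g) (hh : Continuous h) (h0 : ∀ x, h x = 0 → g x = 0) :
    Continuous (fun x => (g x : ℂ) * (h x / (‖h x‖ : ℂ))) := by
  rw [continuous_iff_continuousAt]
  intro x
  by_cases hx : h x = 0
  · have hgx := h0 x hx
    unfold ContinuousAt
    simp only [hx, hgx, Complex.ofReal_zero, zero_mul]
    apply squeeze_zero_norm (a := fun y => |g y|)
    · intro y
      rw [norm_mul, Complex.norm_real, Real.norm_eq_abs]
      refine mul_le_of_le_one_right (abs_nonneg _) ?_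
      rw [norm_div, Complex.norm_real, norm_norm]
      exact div_self_le_one _
    · have := (hg.abs).tendsto x
      simpa [hgx] using this
  · have : (‖h x‖ : ℂ) ≠ 0 := by simpa using hx
    have h1 : Continuous (fun x => (g x : ℂ)) := Complex.continuous_ofReal.comp hg
    have h2 : Continuous (fun x => (‖h x‖ : ℂ)) := Complex.continuous_ofReal.comp hh.norm
    exact h1.continuousAt.mul (hh.continuousAt.div h2.continuousAt this)

theorem polar_norm (a : ℝ) (ha : 0 ≤ a) (z : ℂ) (hz : z = 0 → a = 0) :
    ‖(a : ℂ) * (z / (‖z‖ : ℂ))‖ = a := by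
  by_cases h : z = 0
  · simp [h, hz h]
  · have : ‖z‖ ≠ 0 := by simpa using h
    rw [norm_mul, norm_div, Complex.norm_real, Complex.norm_real, norm_norm, div_self this,
      mul_one, Real.norm_eq_abs, abs_of_nonneg ha]

theorem polar_inv (a b : ℝ) (ha : 0 ≤ a) (z : ℂ) (hz : z = 0 ↔ a = 0) (hb : b = ‖z‖) :
    (b : ℂ) * (((a : ℂ) * (z / (‖z‖ : ℂ))) / (‖(a : ℂ) * (z / (‖z‖ : ℂ))‖ : ℂ)) = z := by
  rw [polar_norm a ha z hz.1, hb]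
  by_cases h : z = 0
  · simp [h]
  · have h1 : (‖z‖ : ℂ) ≠ 0 := by simpa using h
    have h2 : (a : ℂ) ≠ 0 := by
      have := mt hz.2 h
      exact_mod_cast this
    field_simp

/-- If `r₁` is a root of `p(K) = −K³/12 + c₁K + c₂` with `p > 0` on `(−∞, r₁)`, then the
piece of the level set `{I₁ = c₁, I₂ = c₂}` in `ℝ × ℂ × ℝ` lying over `K ≤ r₁` is
homeomorphic to the plane `ℝ² ≃ ℂ`. -/
theorem stmt_14 (c₁ c₂ r₁ : ℝ) (p : ℝ → ℝ)
    (hp : ∀ K, p K = -K ^ 3 / 12 + c₁ * K + c₂)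
    (h₁ : p r₁ = 0)
    (hpos : ∀ K, K < r₁ → 0 < p K)
    (L : Set (ℝ × ℂ × ℝ))
    (hL : L = {q : ℝ × ℂ × ℝ |
      q.1 ^ 2 / 4 - q.2.2 = c₁ ∧
      Complex.normSq q.2.1 + q.1 * q.2.2 - q.1 ^ 3 / 6 = c₂ ∧
      q.1 ≤ r₁}) :
    Nonempty (L ≃ₜ ℂ) := by
  have hp0 : ∀ K, K ≤ r₁ → 0 ≤ p K := by
    intro K hK
    rcases hK.lt_or_eq with h | h
    · exact (hpos K h).le
    · rw [h, h₁]
  have hpz : ∀ K, K ≤ r₁ → (p K = 0 ↔ K = r₁) := by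
    intro K hK
    constructor
    · intro h
      by_contra hne
      exact (hpos K (lt_of_le_of_ne hK hne)).ne' h
    · rintro rfl
      exact h₁
  have hpc : Continuous p := by
    rw [funext hp]
    fun_prop
  have hmem : ∀ q : ℝ × ℂ × ℝ, q ∈ L ↔
      q.2.2 = q.1 ^ 2 / 4 - c₁ ∧ ‖q.2.1‖ = √(p q.1) ∧ q.1 ≤ r₁ := by
    intro q
    rw [hL]
    constructor
    · rintro ⟨ha, hb, hc⟩
      have hU : q.2.2 = q.1 ^ 2 / 4 - c₁ := by linarith
      refine ⟨hU, ?_, hc⟩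
      rw [eq_comm, Real.sqrt_eq_iff_mul_self_eq (hp0 _ hc) (norm_nonneg _), ← sq, ← Complex.normSq_eq_norm_sq, hp]
      rw [hU] at hb
      linarith
    · rintro ⟨hU, hb, hc⟩
      refine ⟨by linarith, ?_, hc⟩
      rw [Complex.normSq_eq_norm_sq, hb, Real.sq_sqrt (hp0 _ hc), hp, hU]
      ring
  have hT : ∀ q ∈ L, (q.2.1 = 0 ↔ r₁ - q.1 = 0) := by
    intro q hq
    obtain ⟨-, hb, hc⟩ := (hmem q).1 hq
    rw [← norm_eq_zero, hb, Real.sqrt_eq_zero (hp0 _ hc), hpz _ hc, sub_eq_zero, eq_comm]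
  have hz : ∀ z : ℂ, z = 0 ↔ √(p (r₁ - ‖z‖)) = 0 := by
    intro z
    have hle : r₁ - ‖z‖ ≤ r₁ := by linarith [norm_nonneg z]
    rw [Real.sqrt_eq_zero (hp0 _ hle), hpz _ hle, sub_eq_self, norm_eq_zero]
  refine ⟨{
    toFun := fun q => ((r₁ - q.1.1 : ℝ) : ℂ) * (q.1.2.1 / (‖q.1.2.1‖ : ℂ))
    invFun := fun z => ⟨(r₁ - ‖z‖, ((√(p (r₁ - ‖z‖)) : ℝ) : ℂ) * (z / (‖z‖ : ℂ)),
      (r₁ - ‖z‖) ^ 2 / 4 - c₁), (hmem _).2 ⟨rfl,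
        polar_norm _ (Real.sqrt_nonneg _) z (hz z).1, by simp⟩⟩
    left_inv := ?_
    right_inv := ?_
    continuous_toFun := ?_
    continuous_invFun := ?_ }⟩
  · rintro ⟨⟨K, T, U⟩, hq⟩
    obtain ⟨ha, hb, hc⟩ := (hmem _).1 hq
    have ht := hT _ hq
    simp only at ha hb hc ht
    have hn := polar_norm (r₁ - K) (by linarith) T ht.1
    have hK : r₁ - ‖((r₁ - K : ℝ) : ℂ) * (T / (‖T‖ : ℂ))‖ = K := by rw [hn]; ring
    apply Subtype.ext
    refine Prod.ext hK (Prod.ext ?_ ?_)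
    · simp only [hK]
      exact polar_inv _ _ (by linarith) T ht hb.symm
    · simp only [hK]
      exact ha.symm
  · intro z
    exact polar_inv _ _ (Real.sqrt_nonneg _) z (hz z) (by ring)
  · exact polar_cont (fun q : L => r₁ - q.1.1) (fun q : L => q.1.2.1) (by fun_prop) (by fun_prop)
      (fun q => (hT q.1 q.2).1)
  · have hc1 : Continuous (fun z : ℂ => √(p (r₁ - ‖z‖))) := by fun_prop
    have := polar_cont (fun z : ℂ => √(p (r₁ - ‖z‖))) (fun z => z) hc1 continuous_id
      (fun z => (hz z).1)
    refine Continuous.subtype_mk ?_ _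
    exact Continuous.prodMk (by fun_prop) (Continuous.prodMk this (by fun_prop))
end

section
/- For (a, b, u) ∈ ℝ × ℝ × ℂ, let x(a,b,u) be the 3×3 complex matrix with rows (i(a − b/2), u, 1 − a), (−conj(u), i·b, −i·conj(u)), (1 − a, i·u, −i(a + b/2)). Then trace(x(a,b,u)·x(a,b,u)) = 2 − 4a − (3/2)b² and det(x(a,b,u)) = −(i/4)·(4b − 8ab + b³ + 8|u|²). -/
/-- For the matrices `x(a,b,u)` of the affine transversal `X ⊂ 𝔰𝔲(2,1)`,
`tr(x²) = 2 − 4a − (3/2)b²` and `det x = −(i/4)(4b − 8ab + b³ + 8|u|²)`. -/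
theorem stmt_15
    (x : ℝ → ℝ → ℂ → Matrix (Fin 3) (Fin 3) ℂ)
    (hx : ∀ (a b : ℝ) (u : ℂ), x a b u =
      !![Complex.I * ((a : ℂ) - (b : ℂ) / 2), u, 1 - (a : ℂ);
         -(starRingEnd ℂ) u, Complex.I * (b : ℂ), -Complex.I * (starRingEnd ℂ) u;
         1 - (a : ℂ), Complex.I * u, -Complex.I * ((a : ℂ) + (b : ℂ) / 2)]) :
    ∀ (a b : ℝ) (u : ℂ),
      (x a b u * x a b u).trace = ((2 - 4 * a - 3 / 2 * b ^ 2 : ℝ) : ℂ) ∧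
      (x a b u).det
        = -(Complex.I / 4) * ((4 * b - 8 * a * b + b ^ 3 + 8 * Complex.normSq u : ℝ) : ℂ) := by
  intro a b u
  have hI := Complex.I_sq
  rw [hx]
  constructor
  · simp only [Matrix.trace_fin_three, Matrix.mul_apply, Fin.sum_univ_three]
    simp
    linear_combination (((a : ℂ) - b / 2) ^ 2 + (b : ℂ) ^ 2 + ((a : ℂ) + b / 2) ^ 2
      - 2 * u * (starRingEnd ℂ) u) * hI
  · rw [Matrix.det_fin_three]
    push_cast
    rw [Complex.normSq_eq_conj_mul_self]
    simp
    linear_combination (Complex.I * ((a : ℂ) - b / 2) *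
      (-(b : ℂ) * (a + b / 2) + u * (starRingEnd ℂ) u)) * hI
end

section
/- For (a, b, u) ∈ ℝ × ℝ × ℂ, let x(a,b,u) be the 3×3 complex matrix with rows (i(a − b/2), u, 1 − a), (−conj(u), i·b, −i·conj(u)), (1 − a, i·u, −i(a + b/2)), and for θ ∈ ℝ let g(θ) be the diagonal 3×3 complex matrix with diagonal entries (e^{−iθ/2}, e^{iθ}, e^{−iθ/2}). Then g(θ) is invertible and g(θ) · x(a,b,u) · g(θ)⁻¹ = x(a, b, e^{−3iθ/2}·u) for all θ, a, b, u. In particular, conjugation by g(θ) preserves the set {x(a,b,u) : (a,b,u) ∈ ℝ × ℝ × ℂ}, acting only by a rotation of the complex coordinate u. -/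
/-- Conjugation by the diagonal matrix `g(θ) = diag(e^{−iθ/2}, e^{iθ}, e^{−iθ/2})` preserves
the affine transversal `{x(a,b,u)} ⊂ 𝔰𝔲(2,1)`, acting by the rotation `u ↦ e^{−3iθ/2} u`. -/
theorem stmt_16
    (x : ℝ → ℝ → ℂ → Matrix (Fin 3) (Fin 3) ℂ)
    (hx : ∀ (a b : ℝ) (u : ℂ), x a b u =
      !![Complex.I * ((a : ℂ) - (b : ℂ) / 2), u, 1 - (a : ℂ);
         -(starRingEnd ℂ) u, Complex.I * (b : ℂ), -Complex.I * (starRingEnd ℂ) u;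
         1 - (a : ℂ), Complex.I * u, -Complex.I * ((a : ℂ) + (b : ℂ) / 2)])
    (g : ℝ → Matrix (Fin 3) (Fin 3) ℂ)
    (hg : ∀ θ : ℝ, g θ = Matrix.diagonal
      ![Complex.exp (-Complex.I * (θ : ℂ) / 2), Complex.exp (Complex.I * (θ : ℂ)),
        Complex.exp (-Complex.I * (θ : ℂ) / 2)]) :
    ∀ (θ a b : ℝ) (u : ℂ),
      IsUnit (g θ) ∧
      g θ * x a b u * (g θ)⁻¹ = x a b (Complex.exp (-3 * Complex.I * (θ : ℂ) / 2) * u) := by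
  intro θ a b u
  have hU : IsUnit (g θ) := by
    rw [Matrix.isUnit_iff_isUnit_det, hg, Matrix.det_diagonal]
    simp [Fin.prod_univ_three, Complex.exp_ne_zero]
  refine ⟨hU, ?_⟩
  have hdet : IsUnit (g θ).det := (Matrix.isUnit_iff_isUnit_det _).1 hU
  have key : g θ * x a b u =
      x a b (Complex.exp (-3 * Complex.I * (θ : ℂ) / 2) * u) * g θ := by
    have h1 : Complex.exp (-Complex.I * (θ : ℂ) / 2) =
        Complex.exp (-3 * Complex.I * (θ : ℂ) / 2) * Complex.exp (Complex.I * (θ : ℂ)) := by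
      rw [← Complex.exp_add]; congr 1; ring
    have h2 : Complex.exp (Complex.I * (θ : ℂ)) =
        (starRingEnd ℂ) (Complex.exp (-3 * Complex.I * (θ : ℂ) / 2)) *
          Complex.exp (-Complex.I * (θ : ℂ) / 2) := by
      rw [← Complex.exp_conj, ← Complex.exp_add]
      congr 1
      simp only [map_div₀, map_mul, map_neg, Complex.conj_I, Complex.conj_ofReal, map_ofNat]
      ring
    rw [hx, hx, hg]
    simp only [map_mul]
    generalize (starRingEnd ℂ) (Complex.exp (-3 * Complex.I * (θ : ℂ) / 2)) = s at *
    generalize Complex.exp (-3 * Complex.I * (θ : ℂ) / 2) = r at *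
    generalize Complex.exp (-Complex.I * (θ : ℂ) / 2) = p at *
    generalize Complex.exp (Complex.I * (θ : ℂ)) = q at *
    ext i j
    rw [Matrix.diagonal_mul, Matrix.mul_diagonal]
    fin_cases i <;> fin_cases j <;> simp
    · ring
    · linear_combination u * h1
    · ring
    · linear_combination (starRingEnd ℂ) u * h2
    · ring
    · linear_combination Complex.I * (starRingEnd ℂ) u * h2
    · ring
    · linear_combination Complex.I * u * h1
    · ring
  rw [key, Matrix.mul_nonsing_inv_cancel_right _ _ hdet]
end
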